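/- Let κ be a regular uncountable cardinal and λ ≥ κ a cardinal. The collection 𝓘(Sp(P_κλ)(unbounded)) = {A ⊆ P_κλ : there is an A-list splitting every unbounded subset of A into unbounded sets} is a κ-complete ideal on P_κλ containing the ideal I_{κ,λ} of non-unbounded subsets of P_κλ. -/

import Mathlib

open Cardinal Set

/-- `P_κλ`: the collection of subsets of `λ` of size less than `κ`. -/
def Pkl (κ lam : Cardinal) : Set (Set Ordinal) :=
  {x | x ⊆ Set.Iio lam.ord ∧ Cardinal.mk ↥x < Cardinal.lift.{1,0} κ}

/-- `U` is an unbounded (cofinal) subset of `P_κλ`. -/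
def PklUnbdd (κ lam : Cardinal) (U : Set (Set Ordinal)) : Prop :=
  U ⊆ Pkl κ lam ∧ ∀ x ∈ Pkl κ lam, ∃ y ∈ U, x ⊆ y

/-- There is an `A`-list splitting every unbounded subset of `A` into unbounded sets. -/
def SplitsUnbddOn (κ lam : Cardinal) (A : Set (Set Ordinal)) : Prop :=
  ∃ d : Set Ordinal → Set Ordinal, (∀ x ∈ A, d x ⊆ x) ∧
    ∀ X, X ⊆ A → PklUnbdd κ lam X → ∃ β < lam.ord,
      PklUnbdd κ lam {x | x ∈ X ∧ β ∈ d x} ∧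
      PklUnbdd κ lam {x | x ∈ X ∧ β ∈ x ∧ β ∉ d x}

/-- The split ideal `𝓘(Sp(P_κλ)(unbounded))`. -/
def splitIdealU (κ lam : Cardinal) : Set (Set (Set Ordinal)) :=
  {A | A ⊆ Pkl κ lam ∧ SplitsUnbddOn κ lam A}

theorem PklUnbdd.mono {κ lam : Cardinal} {X Y : Set (Set Ordinal)} (hX : PklUnbdd κ lam X)
    (h : X ⊆ Y) (hY : Y ⊆ Pkl κ lam) : PklUnbdd κ lam Y :=
  ⟨hY, fun x hx => (hX.2 x hx).imp fun _ hy => ⟨h hy.1, hy.2⟩⟩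

theorem Pkl.iUnion_mem {κ lam : Cardinal} (hreg : κ.IsRegular) {o : Ordinal} (ho : o < κ.ord)
    {x : Iio o → Set Ordinal} (hx : ∀ i, x i ∈ Pkl κ lam) : (⋃ i, x i) ∈ Pkl κ lam := by
  refine ⟨iUnion_subset fun i => (hx i).1, ?_⟩
  have hreg' : (Cardinal.lift.{1, 0} κ).IsRegular := hreg.lift
  refine (Cardinal.card_iUnion_lt_iff_forall_of_isRegular hreg' ?_).2 fun i => (hx i).2
  rw [Cardinal.mk_Iio_ordinal, Cardinal.lift_lt]
  exact Cardinal.lt_ord.1 ho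

/-- The ideal of non-unbounded sets is `κ`-complete: if fewer than `κ` sets cover an unbounded
set, then one of them meets it in an unbounded set. -/
theorem PklUnbdd.exists_fiber {κ lam : Cardinal} (hreg : κ.IsRegular) {o : Ordinal}
    (ho : o < κ.ord) {X : Set (Set Ordinal)} (hX : PklUnbdd κ lam X)
    {f : Set Ordinal → Ordinal} (hf : ∀ x ∈ X, f x < o) :
    ∃ i < o, PklUnbdd κ lam {x | x ∈ X ∧ f x = i} := by
  by_contra! h
  have h' : ∀ i : Iio o, ∃ x ∈ Pkl κ lam, ∀ y ∈ X, f y = i → ¬ x ⊆ y := by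
    intro i
    by_contra! hi
    refine h i i.2 ⟨fun y hy => hX.1 hy.1, fun x hx => ?_⟩
    obtain ⟨y, hy, hfy, hxy⟩ := hi x hx
    exact ⟨y, ⟨hy, hfy⟩, hxy⟩
  choose x hx hxy using h'
  obtain ⟨y, hy, hsub⟩ := hX.2 _ (Pkl.iUnion_mem hreg ho hx)
  exact hxy ⟨f y, hf y hy⟩ y hy rfl ((subset_iUnion x _).trans hsub)

theorem splitIdealU.of_not_unbdd {κ lam : Cardinal} {A : Set (Set Ordinal)} (hA : A ⊆ Pkl κ lam)
    (h : ¬ PklUnbdd κ lam A) : A ∈ splitIdealU κ lam :=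
  ⟨hA, fun _ => ∅, fun _ _ => empty_subset _, fun _ hXA hX => absurd (hX.mono hXA hA) h⟩

theorem splitIdealU.subset {κ lam : Cardinal} {A B : Set (Set Ordinal)} (hAB : A ⊆ B)
    (hB : B ∈ splitIdealU κ lam) : A ∈ splitIdealU κ lam := by
  obtain ⟨hB, d, hd, hs⟩ := hB
  exact ⟨hAB.trans hB, d, fun x hx => hd x (hAB hx), fun X hX => hs X (hX.trans hAB)⟩

theorem splitIdealU.biUnion {κ lam : Cardinal} (hreg : κ.IsRegular) {o : Ordinal}
    (ho : o < κ.ord) {X : Ordinal → Set (Set Ordinal)} (hX : ∀ i < o, X i ∈ splitIdealU κ lam) :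
    (⋃ i ∈ Iio o, X i) ∈ splitIdealU κ lam := by
  classical
  refine ⟨iUnion₂_subset fun i hi => (hX i hi).1, ?_⟩
  choose! d hd hs using fun i hi => (hX i hi).2
  have hex : ∀ x ∈ ⋃ i ∈ Iio o, X i, ∃ i, i < o ∧ x ∈ X i := by
    intro x hx
    simpa using hx
  choose! f hfo hfX using hex
  refine ⟨fun x => d (f x) x, fun x hx => hd _ (hfo x hx) x (hfX x hx), fun Y hY hYu => ?_⟩
  obtain ⟨i, hi, hYi⟩ := hYu.exists_fiber hreg ho fun x hx => hfo x (hY hx)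
  have hYX : {x | x ∈ Y ∧ f x = i} ⊆ X i := by
    rintro x ⟨hx, rfl⟩
    exact hfX x (hY hx)
  obtain ⟨β, hβ, hpos, hneg⟩ := hs i hi _ hYX hYi
  refine ⟨β, hβ, hpos.mono ?_ fun x hx => hYu.1 hx.1, hneg.mono ?_ fun x hx => hYu.1 hx.1⟩
  · rintro x ⟨⟨hx, rfl⟩, hxβ⟩
    exact ⟨hx, hxβ⟩
  · rintro x ⟨⟨hx, rfl⟩, hxβ⟩
    exact ⟨hx, hxβ⟩

/-- `𝓘(Sp(P_κλ)(unbounded))` is a `κ`-complete ideal on `P_κλ` containing the ideal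
`I_{κ,λ}` of non-unbounded subsets of `P_κλ`: it contains every non-unbounded subset,
is closed under subsets, and is closed under unions of fewer than `κ` of its members. -/
theorem splitIdealU_kappa_complete_ideal (κ lam : Cardinal) (hκ : ℵ₀ < κ)
    (hreg : κ.IsRegular) (hkl : κ ≤ lam) :
    (∀ A, A ⊆ Pkl κ lam → ¬ PklUnbdd κ lam A → A ∈ splitIdealU κ lam) ∧
    (∀ A B : Set (Set Ordinal), A ⊆ B → B ∈ splitIdealU κ lam → A ∈ splitIdealU κ lam) ∧
    (∀ o : Ordinal, o < κ.ord → ∀ X : Ordinal → Set (Set Ordinal),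
      (∀ i < o, X i ∈ splitIdealU κ lam) →
      (⋃ i ∈ Set.Iio o, X i) ∈ splitIdealU κ lam) := by
  exact ⟨fun _ => splitIdealU.of_not_unbdd, fun _ _ => splitIdealU.subset,
    fun _ ho _ => splitIdealU.biUnion hreg ho⟩
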